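/- arXiv:2509.23447 — 2 statements merged into one kernel-verified Lean document; each statement's English description precedes it below -/
import Mathlib

section
/- Let F be a field and let K, L, M be positive integers with K/2 ≤ M < K and L ≤ K − M. Set N = ⌊K/(K−M)⌋ and R = L + ⌈ L / ⌊M/(K−M)⌋ ⌉. Then there exist N subsets 𝓜_1, …, 𝓜_N of {1,…,K}, each of cardinality at most M and depending only on K, L, M, such that for every matrix D ∈ F^{L×K} there exist C ∈ F^{L×R} and A ∈ F^{R×K} with D = C·A and with the support of every row of A contained in 𝓜_n for some n ∈ {1,…,N}. (Theorem 2, second part: the rate L + ⌈L/⌊M/(K−M)⌋⌉ is achievable with N = ⌊K/(K−M)⌋ servers when M ≥ K/2.) -/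
/-- For `n < K / m`, the indices `j < K` outside the `n`-th block of length `m` number
at most `K - m`. -/
lemma card_filter_div_ne_le {K m n : ℕ} (hn : n < K / m) :
    (Finset.univ.filter fun j : Fin K => j.val / m ≠ n).card ≤ K - m := by
  have hm : 0 < m := Nat.pos_of_ne_zero (by rintro rfl; simp at hn)
  have hle : (n + 1) * m ≤ K := (Nat.le_div_iff_mul_le hm).1 hn
  have hlt (i : Fin m) : n * m + i < K := by
    have := i.isLt
    rw [Nat.add_mul] at hle
    omega
  have hblock : m ≤ (Finset.univ.filter fun j : Fin K => j.val / m = n).card := by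
    have := Finset.card_le_card_of_injOn (s := (Finset.univ : Finset (Fin m)))
      (t := Finset.univ.filter fun j : Fin K => j.val / m = n)
      (fun i => ⟨n * m + i, hlt i⟩)
      (fun i _ => by
        simp [Nat.add_comm (n * m), Nat.add_mul_div_right _ _ hm, Nat.div_eq_of_lt i.isLt])
      (fun i _ i' _ h => by
        simp only [Fin.mk.injEq] at h
        exact Fin.ext (by omega))
    simpa using this
  have hsum := Finset.card_filter_add_card_filter_not (s := (Finset.univ : Finset (Fin K)))
    (fun j : Fin K => j.val / m = n)
  rw [Finset.card_univ, Fintype.card_fin] at hsum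
  simp only [ne_eq]
  omega

/-- The mixed transmission serving the `g`-th group of `q` demands: in each column of the `i`-th
block, `i < q`, it agrees with the `i`-th demand of the group. -/
def blockDiagonalRow {F : Type*} [Zero F] {K L : ℕ} (m q : ℕ) (D : Matrix (Fin L) (Fin K) F)
    (g : ℕ) (j : Fin K) : F :=
  if h : j.val / m < q ∧ g * q + j.val / m < L then D ⟨g * q + j.val / m, h.2⟩ j else 0

lemma blockDiagonalRow_eq {F : Type*} [Zero F] {K L m q : ℕ} (hq : 0 < q)
    (D : Matrix (Fin L) (Fin K) F) (l : Fin L) (j : Fin K) (h : j.val / m = l.val % q) :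
    blockDiagonalRow m q D (l / q) j = D l j := by
  have hl : l.val / q * q + l.val % q = l := Nat.div_add_mod' _ _
  unfold blockDiagonalRow
  rw [dif_pos ⟨h ▸ Nat.mod_lt _ hq, by rw [h, hl]; exact l.isLt⟩]
  congr 1
  exact Fin.ext (by simp only [h, hl])


/-- Theorem 2, second part: If `K/2 ≤ M < K` and `L ≤ K − M`,
then with `N = ⌊K/(K−M)⌋` and `R = L + ⌈L/⌊M/(K−M)⌋⌉` there exist `N`
task-assignment sets of size at most `M`, independent of the demand matrix,
such that every `D ∈ F^{L×K}` factors as `D = C·A` with every row of `A`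
supported inside one of the sets. -/
theorem scheme2_general_rate_achievable
    (F : Type*) [Field F] (K L M : ℕ)
    (hK : 0 < K) (hL : 0 < L) (hM : 0 < M)
    (hhalf : K ≤ 2 * M) (hMK : M < K) (hLKM : L ≤ K - M)
    (N R : ℕ) (hN : N = K / (K - M))
    (hR : R = L + ⌈(L : ℚ) / (M / (K - M) : ℕ)⌉₊) :
    ∃ 𝓜 : Fin N → Finset (Fin K),
      (∀ n, (𝓜 n).card ≤ M) ∧
      ∀ D : Matrix (Fin L) (Fin K) F,
        ∃ (C : Matrix (Fin L) (Fin R) F) (A : Matrix (Fin R) (Fin K) F),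
          D = C * A ∧
          ∀ r : Fin R, ∃ n : Fin N, ∀ j : Fin K, A r j ≠ 0 → j ∈ 𝓜 n := by
  set m := K - M with hm
  set q := M / m with hqdef
  have hm0 : 0 < m := by omega
  have hq : 0 < q := Nat.div_pos (by omega) hm0
  have hNq : N = q + 1 := by
    rw [hN, hqdef, ← Nat.add_div_right _ hm0]
    congr 1
    omega
  obtain ⟨G, hG⟩ : ∃ G, G = ⌈(L : ℚ) / (q : ℕ)⌉₊ := ⟨_, rfl⟩
  have hgroup (l : Fin L) : l.val / q < G := by
    rw [hG, Nat.lt_ceil, lt_div_iff₀ (by exact_mod_cast hq)]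
    exact_mod_cast (Nat.div_mul_le_self _ _).trans_lt l.isLt
  rw [← hG] at hR
  subst hR
  refine ⟨fun n => Finset.univ.filter fun j => j.val / m ≠ n, fun n => ?_, fun D => ?_⟩
  · exact (card_filter_div_ne_le (hN ▸ n.isLt : n.val < K / m)).trans (by omega)
  let V : Matrix (Fin G) (Fin K) F := fun g => blockDiagonalRow m q D g
  let S : Matrix (Fin L) (Fin G) F := fun l g => if (⟨l / q, hgroup l⟩ : Fin G) = g then 1 else 0
  have hSV (l : Fin L) (j : Fin K) : (S * V) l j = blockDiagonalRow m q D (l / q) j := by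
    rw [Matrix.mul_apply]
    simp [S, V]
  refine ⟨(Matrix.fromCols 1 S).submatrix id finSumFinEquiv.symm,
    (Matrix.fromRows (D - S * V) V).submatrix finSumFinEquiv.symm id, ?_, fun r => ?_⟩
  · rw [Matrix.submatrix_mul_equiv, Matrix.fromCols_mul_fromRows]
    simp
  · obtain ⟨s, rfl⟩ := finSumFinEquiv.surjective r
    rcases s with l | g
    · refine ⟨⟨l % q, by have := Nat.mod_lt l.val hq; omega⟩, fun j hj => ?_⟩
      simp only [Finset.mem_filter, Finset.mem_univ, true_and]
      intro h
      apply hj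
      simp only [Matrix.submatrix_apply, Equiv.symm_apply_apply, Matrix.fromRows_apply_inl,
        Matrix.sub_apply, id_eq, hSV, blockDiagonalRow_eq hq D l j h, sub_self]
    · refine ⟨⟨q, by omega⟩, fun j hj => ?_⟩
      simp only [Finset.mem_filter, Finset.mem_univ, true_and]
      intro h
      apply hj
      simp only [Matrix.submatrix_apply, Equiv.symm_apply_apply, Matrix.fromRows_apply_inr, id_eq]
      exact dif_neg fun hlt => hlt.1.ne h
end

section
/- Let K, L, M, q, R be positive integers with 2 ≤ L ≤ K, M ≤ K, and q ≥ e·K/M (e being Euler's number), and suppose q is a prime power and every matrix D ∈ F_q^{L×K} admits a factorization D = C·A with C ∈ F_q^{L×R}, A ∈ F_q^{R×K}, and every row of A having at most M nonzero entries. Then min( K, L·⌈K/(L+M−1)⌉ ) ≤ 3R; moreover, if in addition (L+M−1) divides K, then L·K/(L+M−1) ≤ 2R. (Theorem 4 / thm:gap: the achievable rate of Scheme 1 is within a factor 2 of optimal when (L+M−1) | K, and within a factor 3 of optimal in general, for field size q ≥ eK/M.) -/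
open Finset in
/-- The number of vectors over a finite alphabet with at most `M` nonzero entries. -/
theorem card_sparse_le {ι F : Type*} [Fintype ι] [DecidableEq ι] [Zero F] [Fintype F] [DecidableEq F]
    {M : ℕ} (hM : M ≤ Fintype.card ι) :
    #{a : ι → F | #{j | a j ≠ 0} ≤ M} ≤ (Fintype.card ι).choose M * Fintype.card F ^ M := by
  classical
  have hsub : ({a : ι → F | #{j | a j ≠ 0} ≤ M} : Finset (ι → F)) ⊆
      (powersetCard M univ).biUnion fun T : Finset ι =>
        Fintype.piFinset fun j => if j ∈ T then (univ : Finset F) else {0} := by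
    intro a ha
    obtain ⟨T, hT, hcard⟩ := exists_superset_card_eq (mem_filter.mp ha).2 hM
    simp only [mem_biUnion, mem_powersetCard, Fintype.mem_piFinset]
    refine ⟨T, ⟨subset_univ _, hcard⟩, fun j => ?_⟩
    split_ifs with hj
    · exact mem_univ _
    · by_contra h
      exact hj (hT (by simpa using h))
  refine (card_le_card hsub).trans ?_
  refine (card_biUnion_le_card_mul _ _ (Fintype.card F ^ M) fun T hT => ?_).trans ?_
  · rw [Fintype.card_piFinset]
    have hcard : ∀ j, #(if j ∈ T then (univ : Finset F) else {0}) =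
        if j ∈ T then Fintype.card F else 1 := by
      intro j; split_ifs <;> simp
    simp [hcard, (mem_powersetCard.mp hT).2]
  · simp

theorem choose_le_exp_mul_div_pow {K M : ℕ} (hM : 0 < M) :
    (K.choose M : ℝ) ≤ (Real.exp 1 * K / M) ^ M := by
  have hM' : (0 : ℝ) < M := by exact_mod_cast hM
  have hexp : (M : ℝ) ^ M / M.factorial ≤ Real.exp 1 ^ M := by
    rw [← Real.exp_nat_mul, mul_one]
    exact Real.pow_div_factorial_le_exp (M : ℝ) hM'.le M
  calc (K.choose M : ℝ) ≤ (K : ℝ) ^ M / M.factorial := Nat.choose_le_pow_div M K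
    _ = (K / M : ℝ) ^ M * ((M : ℝ) ^ M / M.factorial) := by
        rw [div_pow]; field_simp
    _ ≤ (K / M : ℝ) ^ M * Real.exp 1 ^ M := by gcongr
    _ = (Real.exp 1 * K / M) ^ M := by rw [← mul_pow]; ring

open Finset in
/-- If every matrix factors through sparse rows, counting the factorizations bounds the number
of matrices. -/
theorem card_pow_le_of_sparse_factorization {F l m n : Type*} [Field F] [Fintype F]
    [DecidableEq F] [Fintype l] [Fintype m] [Fintype n] {M : ℕ} (hM : M ≤ Fintype.card n)
    (hach : ∀ D : Matrix l n F, ∃ (C : Matrix l m F) (A : Matrix m n F),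
      D = C * A ∧ ∀ r, #{j | A r j ≠ 0} ≤ M) :
    Fintype.card F ^ (Fintype.card l * Fintype.card n) ≤
      Fintype.card F ^ (Fintype.card l * Fintype.card m) *
        ((Fintype.card n).choose M * Fintype.card F ^ M) ^ Fintype.card m := by
  classical
  let S : Finset (n → F) := {a | #{j | a j ≠ 0} ≤ M}
  have hsurj : Function.Surjective
      fun p : (l → m → F) × (m → S) =>
        (Matrix.of p.1 * Matrix.of (fun r => (p.2 r : n → F)) : Matrix l n F) := by
    intro D
    obtain ⟨C, A, rfl, hA⟩ := hach D
    exact ⟨(C, fun r => ⟨A r, by simpa [S] using hA r⟩), rfl⟩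
  have hcard : Fintype.card (l → n → F) ≤ Fintype.card ((l → m → F) × (m → S)) :=
    Fintype.card_le_of_surjective _ hsurj
  simp only [Fintype.card_prod, Fintype.card_fun, Fintype.card_coe, ← pow_mul] at hcard
  rw [mul_comm (Fintype.card l), mul_comm (Fintype.card l)]
  exact hcard.trans (by gcongr; exact card_sparse_le hM)

theorem le_of_forall_exists_factorization {F : Type*} [Field F] {L K R : ℕ} (hLK : L ≤ K)
    (hfac : ∀ D : Matrix (Fin L) (Fin K) F,
      ∃ (C : Matrix (Fin L) (Fin R) F) (A : Matrix (Fin R) (Fin K) F), D = C * A) :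
    L ≤ R := by
  let E : Matrix (Fin L) (Fin K) F :=
    (1 : Matrix (Fin K) (Fin K) F).submatrix (Fin.castLE hLK) id
  have hE : E * E.transpose = 1 := by
    simp only [E, Matrix.transpose_submatrix, Matrix.transpose_one]
    rw [← Matrix.submatrix_mul _ _ _ _ _ Function.bijective_id, Matrix.one_mul,
      Matrix.submatrix_one _ (Fin.castLE_injective hLK)]
  obtain ⟨C, A, hCA⟩ := hfac E
  have hone : C * (A * E.transpose) = 1 := by rw [← Matrix.mul_assoc, ← hCA, hE]
  calc L = (1 : Matrix (Fin L) (Fin L) F).rank := by simp [Matrix.rank_one]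
    _ ≤ C.rank := hone ▸ Matrix.rank_mul_le_left _ _
    _ ≤ R := by simpa using C.rank_le_card_width


/-- Theorem 4 / thm:gap: If `2 ≤ L ≤ K`, `M ≤ K`,
`q ≥ eK/M` is the (prime power) size of the field `F`, and every demand
matrix over `F` admits a rate-`R` factorization with `M`-sparse encoding
rows, then Scheme 1's rate `min(K, L⌈K/(L+M−1)⌉)` is at most `3R`, and at
most `2R` when `(L+M−1) | K` (in which case it equals `LK/(L+M−1)`). -/
theorem scheme1_optimality_gap
    (F : Type*) [Field F] [Fintype F] [DecidableEq F]
    (q K L M R : ℕ) (hq : q = Fintype.card F) (hq_pp : IsPrimePow q)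
    (hL2 : 2 ≤ L) (hLK : L ≤ K) (hM : 0 < M) (hMK : M ≤ K) (hR : 0 < R)
    (hq_big : Real.exp 1 * K / M ≤ (q : ℝ))
    (hach : ∀ D : Matrix (Fin L) (Fin K) F,
      ∃ (C : Matrix (Fin L) (Fin R) F) (A : Matrix (Fin R) (Fin K) F),
        D = C * A ∧
        ∀ r : Fin R, (Finset.univ.filter fun j : Fin K => A r j ≠ 0).card ≤ M) :
    min K (L * ⌈(K : ℚ) / (L + M - 1 : ℕ)⌉₊) ≤ 3 * R ∧
    ((L + M - 1) ∣ K → L * K / (L + M - 1) ≤ 2 * R) := by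
  have hK : 0 < K := hM.trans_le hMK
  have hq1 : 1 < q := hq_pp.one_lt
  have hLR : L ≤ R := le_of_forall_exists_factorization hLK fun D => by
    obtain ⟨C, A, h, -⟩ := hach D
    exact ⟨C, A, h⟩
  have hchoose : K.choose M ≤ q ^ M := by
    have h := (choose_le_exp_mul_div_pow (K := K) hM).trans
      (pow_le_pow_left₀ (by positivity) hq_big M)
    exact_mod_cast h
  have hcount : L * K ≤ R * (L + 2 * M) := by
    have h := card_pow_le_of_sparse_factorization (by simpa using hMK) hach
    simp only [Fintype.card_fin, ← hq] at h
    refine (Nat.pow_le_pow_iff_right hq1).mp (h.trans ?_)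
    calc q ^ (L * R) * (K.choose M * q ^ M) ^ R
        ≤ q ^ (L * R) * (q ^ M * q ^ M) ^ R := by gcongr
      _ = q ^ (R * (L + 2 * M)) := by
          rw [← pow_add, ← pow_mul, ← pow_add]; congr 1; ring
  obtain ⟨N, hN⟩ : ∃ N, N = L + M - 1 := ⟨_, rfl⟩
  have hNpos : 0 < N := by omega
  have hbound : L * K ≤ 2 * R * N := by
    refine hcount.trans ?_
    rw [mul_comm 2 R, mul_assoc]
    exact Nat.mul_le_mul_left R (by omega)
  rw [← hN]
  refine ⟨(min_le_right _ _).trans ?_, fun _ => Nat.div_le_of_le_mul (by linarith)⟩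
  obtain ⟨t, ht⟩ : ∃ t, t = ⌈(K : ℚ) / (N : ℕ)⌉₊ := ⟨_, rfl⟩
  rw [← ht]
  rcases Nat.lt_or_ge t 3 with h3 | h3
  · nlinarith
  · obtain ⟨s, rfl⟩ : ∃ s, t = s + 1 := ⟨t - 1, by omega⟩
    have hs : s * N < K := by
      have h : (s : ℚ) < (K : ℚ) / N := Nat.lt_ceil.mp (by omega)
      rw [lt_div_iff₀ (by exact_mod_cast hNpos)] at h
      exact_mod_cast h
    have hLs : L * s ≤ 2 * R := by
      refine Nat.le_of_mul_le_mul_right ?_ hNpos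
      nlinarith
    nlinarith
end
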